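/- Let n > 1, let L be the second order cone in ℝ^n, and for A ∈ ℝ^{n×n} define γ(A) = max{⟨Ax,y⟩ : (x,y) ∈ Ω}, where Ω = {(x,y) ∈ L × L : ‖x‖ = ‖y‖ = 1, ⟨x,y⟩ = 0}. Then γ(A) = 0 if and only if A lies in the topological boundary of Z(L) in ℝ^{n×n}. -/

import Mathlib

open Matrix

noncomputable section

/-- The second order cone in `ℝⁿ`: `{(t,u) : t ≥ ‖u‖}` (first coordinate is `t`). -/
def soc (n : ℕ) [NeZero n] : Set (Fin n → ℝ) :=
  {x | Real.sqrt (∑ i, if i = 0 then 0 else (x i) ^ 2) ≤ x 0}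

/-- The boundary of the second order cone: `{(t,u) : t = ‖u‖}`. -/
def socBd (n : ℕ) [NeZero n] : Set (Fin n → ℝ) :=
  {x | Real.sqrt (∑ i, if i = 0 then 0 else (x i) ^ 2) = x 0}

/-- `J = diag(1, -1, …, -1)`. -/
def Jmat (n : ℕ) [NeZero n] : Matrix (Fin n) (Fin n) ℝ :=
  Matrix.diagonal (fun i => if i = 0 then 1 else -1)

/-- The dual cone of a set `K ⊆ ℝⁿ`. -/
def dualCone {n : ℕ} (K : Set (Fin n → ℝ)) : Set (Fin n → ℝ) :=
  {y | ∀ x ∈ K, 0 ≤ x ⬝ᵥ y}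

/-- `A` is a Z-transformation on `K`: `x ∈ K`, `y ∈ K*`, `⟨x,y⟩ = 0` imply `⟨Ax,y⟩ ≤ 0`. -/
def IsZTransf {n : ℕ} (K : Set (Fin n → ℝ)) (A : Matrix (Fin n) (Fin n) ℝ) : Prop :=
  ∀ x ∈ K, ∀ y ∈ dualCone K, x ⬝ᵥ y = 0 → (A.mulVec x) ⬝ᵥ y ≤ 0

/-- The completely positive cone of `C`: all finite sums `∑ uᵢuᵢᵀ` with `uᵢ ∈ C`. -/
def cpCone {n : ℕ} (C : Set (Fin n → ℝ)) : Set (Matrix (Fin n) (Fin n) ℝ) :=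
  {X | ∃ (m : ℕ) (u : Fin m → Fin n → ℝ), (∀ i, u i ∈ C) ∧ X = ∑ i, vecMulVec (u i) (u i)}

/-- The copositive cone of `C`: symmetric matrices `A` with `xᵀAx ≥ 0` for all `x ∈ C`. -/
def copCone {n : ℕ} (C : Set (Fin n → ℝ)) : Set (Matrix (Fin n) (Fin n) ℝ) :=
  {A | Aᵀ = A ∧ ∀ x ∈ C, 0 ≤ x ⬝ᵥ A.mulVec x}

/-- `Ω = {(x,y) ∈ L × L : ‖x‖ = 1 = ‖y‖, ⟨x,y⟩ = 0}`. -/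
def OmegaSet (n : ℕ) [NeZero n] : Set ((Fin n → ℝ) × (Fin n → ℝ)) :=
  {p | p.1 ∈ soc n ∧ p.2 ∈ soc n ∧ Real.sqrt (∑ i, p.1 i ^ 2) = 1 ∧
       Real.sqrt (∑ i, p.2 i ^ 2) = 1 ∧ p.1 ⬝ᵥ p.2 = 0}

/-- `γ(A) = max {⟨Ax,y⟩ : (x,y) ∈ Ω}`. -/
def gammaFun (n : ℕ) [NeZero n] (A : Matrix (Fin n) (Fin n) ℝ) : ℝ :=
  sSup {r | ∃ p ∈ OmegaSet n, r = (A.mulVec p.1) ⬝ᵥ p.2}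

theorem mem_soc_iff {n : ℕ} [NeZero n] (x : Fin n → ℝ) :
    x ∈ soc n ↔ 0 ≤ x 0 ∧ ∑ i, (if i = 0 then 0 else (x i) ^ 2) ≤ (x 0) ^ 2 :=
  Real.sqrt_le_iff

theorem dotProduct_eq_head_add_tail {n : ℕ} [NeZero n] (x y : Fin n → ℝ) :
    x ⬝ᵥ y = x 0 * y 0 + ∑ i, (if i = 0 then 0 else x i * y i) := by
  have h : ∀ i, x i * y i = (if i = 0 then x 0 * y 0 else 0) + (if i = 0 then 0 else x i * y i) := by
    intro i
    split_ifs with hi <;> simp [hi]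
  rw [dotProduct, Finset.sum_congr rfl fun i _ => h i, Finset.sum_add_distrib]
  simp

theorem tail_sum_sq_nonneg {n : ℕ} [NeZero n] (x : Fin n → ℝ) :
    0 ≤ ∑ i, (if i = 0 then 0 else (x i) ^ 2) :=
  Finset.sum_nonneg fun i _ => by split_ifs <;> positivity

theorem dotProduct_nonneg_of_mem_soc {n : ℕ} [NeZero n] {x y : Fin n → ℝ}
    (hx : x ∈ soc n) (hy : y ∈ soc n) : 0 ≤ x ⬝ᵥ y := by
  rw [mem_soc_iff] at hx hy
  have hcs := Finset.sum_mul_sq_le_sq_mul_sq Finset.univ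
    (fun i => if i = 0 then 0 else x i) (fun i => if i = 0 then 0 else y i)
  simp only [ite_mul, mul_ite, zero_mul, mul_zero, ite_pow, ne_eq, OfNat.ofNat_ne_zero,
    not_false_eq_true, zero_pow] at hcs
  have hsum : ∑ i, (if i = 0 then (0 : ℝ) else if i = 0 then 0 else x i * y i)
      = ∑ i, (if i = 0 then 0 else x i * y i) :=
    Finset.sum_congr rfl fun i _ => by split_ifs <;> rfl
  rw [hsum] at hcs
  rw [dotProduct_eq_head_add_tail]
  have hmul := mul_le_mul hx.2 hy.2 (tail_sum_sq_nonneg y) (sq_nonneg _)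
  have habs := abs_le_of_sq_le_sq' ((hcs.trans hmul).trans_eq (mul_pow _ _ 2).symm)
    (mul_nonneg hx.1 hy.1)
  linarith [habs.1]

/-- The second order cone is self-dual. -/
theorem dualCone_soc (n : ℕ) [NeZero n] : dualCone (soc n) = soc n := by
  refine Set.Subset.antisymm (fun y hy => ?_) fun y hy x hx => dotProduct_nonneg_of_mem_soc hx hy
  set S := ∑ i, (if i = 0 then 0 else (y i) ^ 2) with hS
  have hS0 : 0 ≤ S := tail_sum_sq_nonneg y
  have hy0 : 0 ≤ y 0 := by
    have h := hy (Pi.single 0 1) <| by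
      rw [mem_soc_iff]
      refine ⟨by simp, ?_⟩
      rw [Finset.sum_eq_zero fun i _ => by split_ifs with hi <;> simp [hi]]
      positivity
    simpa using h
  have hu := hy (fun i => if i = 0 then Real.sqrt S else -y i) <| by
    rw [mem_soc_iff]
    refine ⟨by simp, ?_⟩
    rw [if_pos rfl, Real.sq_sqrt hS0, hS]
    refine (Finset.sum_congr rfl fun i _ => ?_).le
    split_ifs <;> ring
  rw [dotProduct_eq_head_add_tail, if_pos rfl] at hu
  have hneg : ∑ i, (if i = 0 then 0 else (if i = 0 then Real.sqrt S else -y i) * y i) = -S := by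
    rw [hS, ← Finset.sum_neg_distrib]
    refine Finset.sum_congr rfl fun i _ => ?_
    split_ifs <;> ring
  rw [hneg] at hu
  change Real.sqrt S ≤ y 0
  have hsq := Real.sq_sqrt hS0
  rcases (Real.sqrt_nonneg S).eq_or_lt with h | h
  · rwa [← h]
  · nlinarith

theorem smul_mem_soc {n : ℕ} [NeZero n] {x : Fin n → ℝ} (hx : x ∈ soc n) {c : ℝ} (hc : 0 ≤ c) :
    c • x ∈ soc n := by
  rw [mem_soc_iff] at hx ⊢
  refine ⟨by simpa using mul_nonneg hc hx.1, ?_⟩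
  have h : ∑ i, (if i = 0 then 0 else ((c • x) i) ^ 2)
      = c ^ 2 * ∑ i, (if i = 0 then 0 else (x i) ^ 2) := by
    rw [Finset.mul_sum]
    refine Finset.sum_congr rfl fun i _ => ?_
    split_ifs <;> simp [mul_pow]
  rw [h, Pi.smul_apply, smul_eq_mul, mul_pow]
  exact mul_le_mul_of_nonneg_left hx.2 (sq_nonneg c)

theorem sum_sq_eq_dotProduct {n : ℕ} (x : Fin n → ℝ) : ∑ i, x i ^ 2 = x ⬝ᵥ x :=
  Finset.sum_congr rfl fun i _ => sq (x i)

theorem mem_OmegaSet_iff {n : ℕ} [NeZero n] (p : (Fin n → ℝ) × (Fin n → ℝ)) :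
    p ∈ OmegaSet n ↔ p.1 ∈ soc n ∧ p.2 ∈ soc n ∧ p.1 ⬝ᵥ p.1 = 1 ∧ p.2 ⬝ᵥ p.2 = 1 ∧
      p.1 ⬝ᵥ p.2 = 0 := by
  simp only [OmegaSet, Set.mem_ofPred_eq, Real.sqrt_eq_one, sum_sq_eq_dotProduct]

theorem dotProduct_self_normalize {n : ℕ} {x : Fin n → ℝ} (hx : 0 < x ⬝ᵥ x) :
    ((Real.sqrt (x ⬝ᵥ x))⁻¹ • x) ⬝ᵥ ((Real.sqrt (x ⬝ᵥ x))⁻¹ • x) = 1 := by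
  have h := Real.sqrt_pos.2 hx
  rw [smul_dotProduct, dotProduct_smul, smul_eq_mul, smul_eq_mul]
  nth_rewrite 3 [← Real.sq_sqrt hx.le]
  field_simp

theorem isZTransf_soc_iff {n : ℕ} [NeZero n] (B : Matrix (Fin n) (Fin n) ℝ) :
    IsZTransf (soc n) B ↔ ∀ p ∈ OmegaSet n, (B.mulVec p.1) ⬝ᵥ p.2 ≤ 0 := by
  rw [IsZTransf, dualCone_soc]
  refine ⟨fun h p hp => ?_, fun h x hx y hy hxy => ?_⟩
  · rw [mem_OmegaSet_iff] at hp
    exact h _ hp.1 _ hp.2.1 hp.2.2.2.2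
  · rcases eq_or_ne x 0 with rfl | hx0
    · simp
    rcases eq_or_ne y 0 with rfl | hy0
    · simp
    have hxx : 0 < x ⬝ᵥ x :=
      (sum_sq_eq_dotProduct x ▸ Finset.sum_nonneg fun i _ => sq_nonneg (x i)).lt_of_ne
        fun h0 => hx0 (dotProduct_self_eq_zero.1 h0.symm)
    have hyy : 0 < y ⬝ᵥ y :=
      (sum_sq_eq_dotProduct y ▸ Finset.sum_nonneg fun i _ => sq_nonneg (y i)).lt_of_ne
        fun h0 => hy0 (dotProduct_self_eq_zero.1 h0.symm)
    have hcx := inv_pos.2 (Real.sqrt_pos.2 hxx)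
    have hcy := inv_pos.2 (Real.sqrt_pos.2 hyy)
    have hp := h ((Real.sqrt (x ⬝ᵥ x))⁻¹ • x, (Real.sqrt (y ⬝ᵥ y))⁻¹ • y) <| by
      rw [mem_OmegaSet_iff]
      exact ⟨smul_mem_soc hx hcx.le, smul_mem_soc hy hcy.le, dotProduct_self_normalize hxx,
        dotProduct_self_normalize hyy, by simp [hxy]⟩
    simp only [mulVec_smul, smul_dotProduct, dotProduct_smul, smul_eq_mul] at hp
    exact nonpos_of_mul_nonpos_right (nonpos_of_mul_nonpos_right hp hcy) hcx

theorem isClosed_soc (n : ℕ) [NeZero n] : IsClosed (soc n) := by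
  refine isClosed_le (Real.continuous_sqrt.comp (continuous_finsetSum _ fun i _ => ?_))
    (continuous_apply 0)
  split_ifs
  · exact continuous_const
  · fun_prop

theorem isCompact_OmegaSet (n : ℕ) [NeZero n] : IsCompact (OmegaSet n) := by
  have hcube : IsCompact (Set.Icc (-1 : Fin n → ℝ) 1) := isCompact_Icc
  have hmem : ∀ x : Fin n → ℝ, x ⬝ᵥ x = 1 → x ∈ Set.Icc (-1 : Fin n → ℝ) 1 := by
    intro x hx
    have h : ∀ i, |x i| ≤ 1 := fun i => by
      rw [← sq_le_one_iff_abs_le_one, ← hx, ← sum_sq_eq_dotProduct]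
      exact Finset.single_le_sum (f := fun i => x i ^ 2) (fun j _ => sq_nonneg (x j))
        (Finset.mem_univ i)
    exact ⟨fun i => (abs_le.1 (h i)).1, fun i => (abs_le.1 (h i)).2⟩
  refine (hcube.prod hcube).of_isClosed_subset ?_ fun p hp => ?_
  · have hset : OmegaSet n = {p | p.1 ∈ soc n} ∩ ({p | p.2 ∈ soc n} ∩ ({p | p.1 ⬝ᵥ p.1 = 1} ∩
        ({p | p.2 ⬝ᵥ p.2 = 1} ∩ {p | p.1 ⬝ᵥ p.2 = 0}))) :=
      Set.ext mem_OmegaSet_iff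
    rw [hset]
    exact ((isClosed_soc n).preimage continuous_fst).inter <|
      ((isClosed_soc n).preimage continuous_snd).inter <|
      (isClosed_eq (continuous_fst.dotProduct continuous_fst) continuous_const).inter <|
      (isClosed_eq (continuous_snd.dotProduct continuous_snd) continuous_const).inter <|
      isClosed_eq (continuous_fst.dotProduct continuous_snd) continuous_const
  · rw [mem_OmegaSet_iff] at hp
    exact ⟨hmem _ hp.2.2.1, hmem _ hp.2.2.2.1⟩

theorem OmegaSet_nonempty {n : ℕ} [NeZero n] (hn : 1 < n) : (OmegaSet n).Nonempty := by
  let j : Fin n := ⟨1, hn⟩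
  have hj : j ≠ 0 := by
    intro h
    simpa [j] using congrArg Fin.val h
  have key : ∀ s : ℝ, s ^ 2 = 1 →
      (Real.sqrt 2)⁻¹ • (Pi.single 0 1 + Pi.single j s : Fin n → ℝ) ∈ soc n := by
    intro s hs
    refine smul_mem_soc ?_ (by positivity)
    rw [mem_soc_iff]
    refine ⟨by simp [hj.symm], ?_⟩
    rw [Finset.sum_eq_single j]
    · simp [hj, hj.symm, hs]
    · intro i _ hij
      split_ifs with hi
      · rfl
      · simp [hi, hij]
    · simp
  have h2 : (Real.sqrt 2)⁻¹ * (Real.sqrt 2)⁻¹ = (2 : ℝ)⁻¹ := by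
    rw [← mul_inv, Real.mul_self_sqrt (by norm_num)]
  refine ⟨(_, _), (mem_OmegaSet_iff _).2 ⟨key 1 (by norm_num), key (-1) (by norm_num), ?_, ?_, ?_⟩⟩
  all_goals
    simp only [smul_dotProduct, dotProduct_smul, smul_eq_mul, ← mul_assoc, h2]
    simp [hj, hj.symm]
  all_goals norm_num

theorem exists_gammaFun_isMaxOn {n : ℕ} [NeZero n] (hn : 1 < n) (A : Matrix (Fin n) (Fin n) ℝ) :
    ∃ p ∈ OmegaSet n, gammaFun n A = (A.mulVec p.1) ⬝ᵥ p.2 ∧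
      ∀ q ∈ OmegaSet n, (A.mulVec q.1) ⬝ᵥ q.2 ≤ gammaFun n A := by
  have hcont : Continuous fun p : (Fin n → ℝ) × (Fin n → ℝ) => (A.mulVec p.1) ⬝ᵥ p.2 :=
    (continuous_const.matrix_mulVec continuous_fst).dotProduct continuous_snd
  obtain ⟨p, hp, hmax⟩ :=
    (isCompact_OmegaSet n).exists_isMaxOn (OmegaSet_nonempty hn) hcont.continuousOn
  have hgreat : IsGreatest {r | ∃ p ∈ OmegaSet n, r = (A.mulVec p.1) ⬝ᵥ p.2}
      ((A.mulVec p.1) ⬝ᵥ p.2) := by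
    refine ⟨⟨p, hp, rfl⟩, ?_⟩
    rintro r ⟨q, hq, rfl⟩
    exact hmax hq
  have hγ : gammaFun n A = (A.mulVec p.1) ⬝ᵥ p.2 := hgreat.csSup_eq
  exact ⟨p, hp, hγ, fun q hq => hγ ▸ hmax hq⟩

theorem isClosed_isZTransf_soc (n : ℕ) [NeZero n] :
    IsClosed {B : Matrix (Fin n) (Fin n) ℝ | IsZTransf (soc n) B} := by
  simp only [isZTransf_soc_iff, Set.ofPred_forall]
  exact isClosed_iInter fun p => isClosed_iInter fun _ =>
    isClosed_le ((continuous_id.matrix_mulVec continuous_const).dotProduct continuous_const)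
      continuous_const

/-- The interior of the cone of Z-transformations is cut out by strict negativity on `Ω`. -/
theorem mem_interior_isZTransf_soc_iff {n : ℕ} [NeZero n] (A : Matrix (Fin n) (Fin n) ℝ) :
    A ∈ interior {B : Matrix (Fin n) (Fin n) ℝ | IsZTransf (soc n) B} ↔
      ∀ p ∈ OmegaSet n, (A.mulVec p.1) ⬝ᵥ p.2 < 0 := by
  rw [mem_interior_iff_mem_nhds]
  refine ⟨fun h p hp => ?_, fun h => ?_⟩
  · have hcont : Continuous fun ε : ℝ => A + ε • vecMulVec p.2 p.1 := by fun_prop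
    have hev : ∀ᶠ ε : ℝ in nhdsWithin 0 (Set.Ioi 0),
        IsZTransf (soc n) (A + ε • vecMulVec p.2 p.1) :=
      nhdsWithin_le_nhds <| hcont.continuousAt.preimage_mem_nhds
        (t := {B | IsZTransf (soc n) B}) (by simpa using h)
    obtain ⟨ε, hε, hpos⟩ := (hev.and self_mem_nhdsWithin).exists
    have hle := (isZTransf_soc_iff _).1 hε p hp
    rw [mem_OmegaSet_iff] at hp
    have hval : (vecMulVec p.2 p.1).mulVec p.1 ⬝ᵥ p.2 = 1 := by
      rw [vecMulVec_mulVec, hp.2.2.1]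
      simp [hp.2.2.2.1]
    rw [add_mulVec, smul_mulVec, add_dotProduct, smul_dotProduct, hval, smul_eq_mul] at hle
    have hpos' : 0 < ε := hpos
    linarith
  · have hcont : Continuous fun z : Matrix (Fin n) (Fin n) ℝ × ((Fin n → ℝ) × (Fin n → ℝ)) =>
        (z.1.mulVec z.2.1) ⬝ᵥ z.2.2 :=
      (continuous_fst.matrix_mulVec (continuous_fst.comp continuous_snd)).dotProduct
        (continuous_snd.comp continuous_snd)
    have hev := (isCompact_OmegaSet n).eventually_forall_of_forall_eventually
      (x₀ := A) (P := fun B p => (B.mulVec p.1) ⬝ᵥ p.2 < 0) fun p hp =>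
        hcont.continuousAt.eventually_lt continuousAt_const (h p hp)
    filter_upwards [hev] with B hB
    exact (isZTransf_soc_iff B).2 fun p hp => (hB p hp).le

theorem stmt12 (n : ℕ) [NeZero n] (hn : 1 < n) (A : Matrix (Fin n) (Fin n) ℝ) :
    gammaFun n A = 0 ↔ A ∈ frontier {B : Matrix (Fin n) (Fin n) ℝ | IsZTransf (soc n) B} := by
  obtain ⟨p, hp, hγ, hmax⟩ := exists_gammaFun_isMaxOn hn A
  rw [(isClosed_isZTransf_soc n).frontier_eq, Set.mem_sdiff, mem_interior_isZTransf_soc_iff,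
    Set.mem_ofPred_eq, isZTransf_soc_iff]
  refine ⟨fun h => ⟨fun q hq => h ▸ hmax q hq, fun hlt => (hlt p hp).ne (hγ ▸ h)⟩, ?_⟩
  rintro ⟨hle, hnot⟩
  refine le_antisymm (hγ ▸ hle p hp) (le_of_not_gt fun hlt => hnot fun q hq => ?_)
  exact (hmax q hq).trans_lt hlt
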